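/- arXiv:1801.02410 — 4 statements merged into one kernel-verified Lean document; each statement's English description precedes it below -/
import Mathlib

section
/- A nonprincipal ultrafilter U on ℕ is rapid if and only if for every infinite set A ⊆ ℕ there is X ∈ U such that |X ∩ {0,…,n−1}| ≤ |A ∩ {0,…,n−1}|² for all n ∈ ℕ. -/
open Filter Set

/-- An ultrafilter on ℕ is nonprincipal if it contains no finite set. -/
def Nonprincipal (U : Ultrafilter ℕ) : Prop := ∀ A : Set ℕ, A.Finite → A ∉ U

/-- Rapid ultrafilter: every `f : ℕ → ℕ` is eventually dominated by the increasing
enumeration of some member. -/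
def IsRapid (U : Ultrafilter ℕ) : Prop :=
  ∀ f : ℕ → ℕ, ∃ X ∈ U, X.Infinite ∧ ∀ᶠ n in Filter.atTop, f n ≤ Nat.nth (· ∈ X) n

/-- The size of an initial piece of a set, as a value of `Nat.count`. -/
theorem ncard_inter_Iio_eq_count (X : Set ℕ) [DecidablePred (· ∈ X)] (n : ℕ) :
    (X ∩ Set.Iio n).ncard = Nat.count (· ∈ X) n := by
  rw [Nat.count_eq_card_filter_range, ← Set.ncard_coe_finset]
  congr 1
  ext x
  simp [and_comm]

open Classical in
/-- A set whose enumeration eventually dominates that of `A` has a tail which is everywhere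
at most as dense as `A`. -/
theorem exists_tail_ncard_le {X A : Set ℕ} (hX : X.Infinite) (hA : A.Infinite)
    (h : ∀ᶠ n in atTop, Nat.nth (· ∈ A) n ≤ Nat.nth (· ∈ X) n) :
    ∃ M, ∀ n, ((X \ Set.Iio M) ∩ Set.Iio n).ncard ≤ (A ∩ Set.Iio n).ncard := by
  obtain ⟨N, hN⟩ := eventually_atTop.1 h
  refine ⟨Nat.nth (· ∈ X) N, fun n => ?_⟩
  rcases le_or_gt n (Nat.nth (· ∈ X) N) with hn | hn
  · have : (X \ Set.Iio (Nat.nth (· ∈ X) N)) ∩ Set.Iio n = ∅ := by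
      ext x
      simp only [mem_inter_iff, Set.mem_sdiff, mem_Iio, mem_empty_iff_false, iff_false]
      omega
    simp [this]
  · refine (Set.ncard_le_ncard (inter_subset_inter_left _ sdiff_subset)
      ((Set.finite_Iio n).inter_of_right _)).trans ?_
    rw [ncard_inter_Iio_eq_count, ncard_inter_Iio_eq_count]
    have hc : N < Nat.count (· ∈ X) n := by
      by_contra! hle
      exact absurd ((Nat.count_le_iff_le_nth (p := (· ∈ X)) hX).1 hle) (by omega)
    by_contra! hlt
    have h2 : Nat.nth (· ∈ X) (Nat.count (· ∈ X) n - 1) < n :=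
      Nat.nth_lt_of_lt_count (by omega)
    have h3 := hN (Nat.count (· ∈ X) n - 1) (by omega)
    have h4 : n ≤ Nat.nth (· ∈ A) (Nat.count (· ∈ X) n - 1) :=
      (Nat.count_le_iff_le_nth (p := (· ∈ A)) hA).1 (by omega)
    omega

/-- For every `f` there is an infinite set with at most `√n` elements below `f n`. -/
theorem exists_infinite_ncard_inter_Iio_le_sqrt (f : ℕ → ℕ) :
    ∃ A : Set ℕ, A.Infinite ∧ ∀ n, (A ∩ Set.Iio (f n)).ncard ≤ Nat.sqrt n := by
  let a : ℕ → ℕ := fun k => k + ∑ i ∈ Finset.range ((k + 1) ^ 2), f i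
  have ha : StrictMono a := fun k l hkl => by
    refine add_lt_add_of_lt_of_le hkl (Finset.sum_le_sum_of_subset ?_)
    exact Finset.range_mono (by gcongr)
  refine ⟨Set.range a, Set.infinite_range_of_injective ha.injective, fun n => ?_⟩
  have hsub : Set.range a ∩ Set.Iio (f n) ⊆ a '' Set.Iio (Nat.sqrt n) := by
    rintro _ ⟨⟨k, rfl⟩, hk⟩
    refine ⟨k, ?_, rfl⟩
    by_contra hle
    have hn : n < (k + 1) ^ 2 :=
      (Nat.lt_succ_sqrt' n).trans_le (Nat.pow_le_pow_left (by simpa using hle) 2)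
    have : f n ≤ ∑ i ∈ Finset.range ((k + 1) ^ 2), f i :=
      Finset.single_le_sum (fun _ _ => Nat.zero_le _) (Finset.mem_range.2 hn)
    have hk' : k + ∑ i ∈ Finset.range ((k + 1) ^ 2), f i < f n := hk
    omega
  calc (Set.range a ∩ Set.Iio (f n)).ncard ≤ (a '' Set.Iio (Nat.sqrt n)).ncard :=
        Set.ncard_le_ncard hsub ((Set.finite_Iio _).image a)
    _ ≤ (Set.Iio (Nat.sqrt n)).ncard := Set.ncard_image_le (Set.finite_Iio _)
    _ = Nat.sqrt n := by rw [← Finset.coe_Iio, Set.ncard_coe_finset, Nat.card_Iio]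

theorem rapid_iff_sparse_in_infinite_sets (U : Ultrafilter ℕ) (hNP : Nonprincipal U) :
    IsRapid U ↔
      ∀ A : Set ℕ, A.Infinite →
        ∃ X ∈ U, ∀ n : ℕ, (X ∩ Set.Iio n).ncard ≤ (A ∩ Set.Iio n).ncard ^ 2 := by
  classical
  constructor
  · intro hU A hA
    obtain ⟨X, hXU, hX, hdom⟩ := hU (Nat.nth (· ∈ A))
    obtain ⟨M, hM⟩ := exists_tail_ncard_le hX hA hdom
    refine ⟨X \ Set.Iio M, ?_, fun n => (hM n).trans (Nat.le_self_pow two_ne_zero _)⟩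
    exact inter_mem hXU (Ultrafilter.compl_mem_iff_notMem.2 (hNP _ (Set.finite_Iio M)))
  · intro h f
    obtain ⟨A, hA, hAf⟩ := exists_infinite_ncard_inter_Iio_le_sqrt f
    obtain ⟨X, hXU, hX⟩ := h A hA
    have hXinf : X.Infinite := fun hfin => hNP X hfin hXU
    refine ⟨X, hXU, hXinf, Eventually.of_forall fun n => ?_⟩
    refine (Nat.count_le_iff_le_nth (p := (· ∈ X)) hXinf).1 ?_
    rw [← ncard_inter_Iio_eq_count]
    exact (hX (f n)).trans ((Nat.pow_le_pow_left (hAf n) 2).trans (Nat.sqrt_le' n))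
end

section
/- If s : ℕ → ℕ tends to infinity (lim inf s(n) = ∞), π : ℕ → ℕ is finite-to-one, and U is a nonprincipal rapid ultrafilter on ℕ, then there is X ∈ U such that |π⁻¹(n) ∩ X| ≤ s(n) for every n ∈ ℕ. -/
open Filter Set

/-- A map is finite-to-one if every point has finite preimage. -/
def FinToOne (f : ℕ → ℕ) : Prop := ∀ n : ℕ, (f ⁻¹' {n}).Finite

theorem rapid_growth (s : ℕ → ℕ) (hs : Filter.Tendsto s Filter.atTop Filter.atTop)
    (π : ℕ → ℕ) (hπ : FinToOne π)
    (U : Ultrafilter ℕ) (hNP : Nonprincipal U) (hR : IsRapid U) :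
    ∃ X ∈ U, ∀ n : ℕ, ((π ⁻¹' {n}) ∩ X).ncard ≤ s n := by
  classical
  have hfin : ∀ k, {j | s (π j) ≤ k}.Finite := fun k => by
    have hk : {n | s n ≤ k}.Finite := by
      have h := hs.eventually_gt_atTop k
      rw [← Nat.cofinite_eq_atTop] at h
      simpa [Filter.eventually_cofinite] using h
    exact hk.preimage' fun n _ => hπ n
  choose f hf using fun k => (hfin k).bddAbove
  obtain ⟨X, hXU, hXinf, hX⟩ := hR fun k => f k + 1
  obtain ⟨N, hN⟩ := eventually_atTop.1 hX
  refine ⟨X ∩ {j | s (π j) ≤ N}ᶜ, inter_mem hXU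
    (Ultrafilter.compl_mem_iff_notMem.2 (hNP _ (hfin N))), fun n => ?_⟩
  by_cases hn : s n ≤ N
  · have hempty : π ⁻¹' {n} ∩ (X ∩ {j | s (π j) ≤ N}ᶜ) = ∅ := by
      rw [eq_empty_iff_forall_notMem]
      rintro j ⟨rfl, -, hj⟩
      exact hj hn
    simp [hempty]
  · have hsub : π ⁻¹' {n} ∩ (X ∩ {j | s (π j) ≤ N}ᶜ) ⊆
        ((Finset.range (Nat.nth (· ∈ X) (s n))).filter (· ∈ X) : Finset ℕ) := by
      rintro j ⟨rfl, hjX, -⟩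
      have hj : j ≤ f (s (π j)) := hf (s (π j)) (le_refl (s (π j)))
      have hle := hN (s (π j)) (by omega)
      simp only [Finset.coe_filter, Finset.mem_range, mem_ofPred_eq]
      exact ⟨by omega, hjX⟩
    refine (ncard_le_ncard hsub (Finset.finite_toSet _)).trans ?_
    rw [ncard_coe_finset, ← Nat.count_eq_card_filter_range]
    exact (Nat.count_nth_of_infinite (p := (· ∈ X)) hXinf (s n)).le
end

section
/- The Rudin-Keisler and Rudin-Blass orderings coincide below every P-point: if V is a nonprincipal P-point ultrafilter on ℕ and U is a nonprincipal ultrafilter on ℕ with U ≤_RK V, then U ≤_RB V, i.e. there is a finite-to-one map f : ℕ → ℕ with U = f_*(V). -/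
open Filter Set

/-- P-point: every countable sequence of members has a pseudo-intersection in the
ultrafilter. -/
def IsPPoint (U : Ultrafilter ℕ) : Prop :=
  ∀ X : ℕ → Set ℕ, (∀ n, X n ∈ U) → ∃ Y ∈ U, ∀ n, (Y \ X n).Finite

/-- Rudin-Keisler ordering: `U ≤_RK V` iff `U` is the pushforward of `V` by some map. -/
def RKle (U V : Ultrafilter ℕ) : Prop := ∃ f : ℕ → ℕ, U = Ultrafilter.map f V

/-- Rudin-Blass ordering: `U ≤_RB V` iff `U` is the pushforward of `V` by some
finite-to-one map. -/
def RBle (U V : Ultrafilter ℕ) : Prop :=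
  ∃ f : ℕ → ℕ, FinToOne f ∧ U = Ultrafilter.map f V

theorem rk_eq_rb_below_ppoint
    (V : Ultrafilter ℕ) (hVnp : Nonprincipal V) (hVpp : IsPPoint V)
    (U : Ultrafilter ℕ) (hUnp : Nonprincipal U) (hUV : RKle U V) :
    RBle U V := by
  classical
  obtain ⟨f, rfl⟩ := hUV
  obtain ⟨Y, hY, hYfin⟩ := hVpp (fun n => (f ⁻¹' {n})ᶜ) fun n =>
    Ultrafilter.compl_mem_iff_notMem.mpr fun h =>
      hUnp {n} (Set.finite_singleton n) (Ultrafilter.mem_map.mpr h)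
  refine ⟨fun x => if x ∈ Y then f x else x, fun n => ?_, ?_⟩
  · refine ((hYfin n).union (Set.finite_singleton n)).subset fun x hx => ?_
    by_cases hxY : x ∈ Y <;> simp_all
  · refine Ultrafilter.coe_injective ?_
    simp only [Ultrafilter.coe_map]
    refine Filter.map_congr ?_
    filter_upwards [hY] with x hx
    simp [hx]
end

section
/- Being a P-point is preserved downward in the Rudin-Keisler ordering: if V is a nonprincipal P-point ultrafilter on ℕ and U is a nonprincipal ultrafilter on ℕ with U ≤_RK V, then U is a P-point. -/
open Filter Set

theorem ppoint_downward_closed_rk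
    (V : Ultrafilter ℕ) (hVnp : Nonprincipal V) (hVpp : IsPPoint V)
    (U : Ultrafilter ℕ) (hUnp : Nonprincipal U) (hUV : RKle U V) :
    IsPPoint U := by
  obtain ⟨f, rfl⟩ := hUV
  intro X hX
  obtain ⟨Z, hZ, hZX⟩ := hVpp (fun n => f ⁻¹' X n) fun n => Ultrafilter.mem_map.1 (hX n)
  refine ⟨f '' Z, Ultrafilter.mem_map.2 (mem_of_superset hZ (subset_preimage_image f Z)), ?_⟩
  intro n
  refine ((hZX n).image f).subset ?_
  rintro _ ⟨⟨z, hz, rfl⟩, hzX⟩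
  exact ⟨z, ⟨hz, hzX⟩, rfl⟩
end
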